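/- For every positive integer k there exist constants o_k with k/2 ≤ o_k < k and c_k > 0 such that the following holds: if b = b(n) satisfies b ≥ o_k·n + c_k·√n·log n, then there exists a (τ_k, b)-strategy B of Builder such that the probability that the purchased graph B_{τ_k} has minimum degree at least k tends to 1 as n → ∞. -/

import Mathlib

open Filter

attribute [local instance] Classical.propDecidable

/-- The edges of the complete graph on `Fin n`: non-diagonal unordered pairs. -/
abbrev CEdge (n : ℕ) : Type := {e : Sym2 (Fin n) // ¬ e.IsDiag}

/-- The sample space: a uniformly random ordering of the edges of `K_n`,
encoded as a bijection from positions to edges. -/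
abbrev EdgeOrdering (n : ℕ) : Type := Fin (Fintype.card (CEdge n)) ≃ CEdge n

/-- The uniform probability of an event on a finite sample space. -/
noncomputable def uprob {α : Type} [Fintype α] (P : α → Prop) : ℝ :=
  ((Finset.univ.filter P).card : ℝ) / (Fintype.card α : ℝ)

/-- A (deterministic) strategy of Builder: given the current time `s`, the graph `B_{s-1}`
of previously purchased edges, and the observed edge `e_s`, decide whether to purchase it. -/
def Strategy (n : ℕ) : Type := ℕ → Finset (CEdge n) → CEdge n → Bool

/-- Builder's purchased graph `B_s` at time `s`, playing strategy `S` with budget `b`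
on the ordering `ω`.  An edge is purchased iff the strategy accepts it and the budget permits. -/
noncomputable def build (n b : ℕ) (S : Strategy n) (ω : EdgeOrdering n) : ℕ → Finset (CEdge n)
  | 0 => ∅
  | s + 1 =>
    let P := build n b S ω s
    if h : s < Fintype.card (CEdge n) then
      if S s P (ω ⟨s, h⟩) = true ∧ P.card < b then insert (ω ⟨s, h⟩) P else P
    else P

/-- The degree of the vertex `v` in the graph given by the edge set `P`. -/
noncomputable def edegree (n : ℕ) (P : Finset (CEdge n)) (v : Fin n) : ℕ :=
  (P.filter (fun e => v ∈ (e : Sym2 (Fin n)))).card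

/-- The graph `G_s` of the first `s` observed edges. -/
noncomputable def observed (n : ℕ) (ω : EdgeOrdering n) (s : ℕ) : Finset (CEdge n) :=
  Finset.univ.filter (fun e => ((ω.symm e : ℕ)) < s)

/-- The hitting time `τ_k`: the least `s` such that `G_s` has minimum degree at least `k`. -/
noncomputable def hitTime (n k : ℕ) (ω : EdgeOrdering n) : ℕ :=
  sInf {s | ∀ v : Fin n, k ≤ edegree n (observed n ω s) v}

section Counting

variable {E : Type} [Fintype E] [DecidableEq E] {N : ℕ}

/-- The orderings of `E` whose first `m` entries lie in `A`. -/
noncomputable def startsIn (N : ℕ) (A : Finset E) (m : ℕ) : Finset (Fin N ≃ E) :=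
  Finset.univ.filter fun ω => ∀ i : Fin N, (i : ℕ) < m → ω i ∈ A

theorem mem_startsIn {A : Finset E} {m : ℕ} {ω : Fin N ≃ E} :
    ω ∈ startsIn N A m ↔ ∀ i : Fin N, (i : ℕ) < m → ω i ∈ A := by
  simp [startsIn]

theorem card_startsIn_succ_le_filter (A : Finset E) {m : ℕ} (hm : m < N) (j : Fin N) :
    (startsIn N A (m + 1)).card ≤ ((startsIn N A m).filter fun ω => ω j ∈ A).card := by
  by_cases hj : (j : ℕ) < m
  · apply Finset.card_le_card
    intro ω hω
    rw [mem_startsIn] at hω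
    rw [Finset.mem_filter, mem_startsIn]
    exact ⟨fun i hi => hω i (by omega), hω j (by omega)⟩
  · apply Finset.card_le_card_of_injOn (fun ω => (Equiv.swap ⟨m, hm⟩ j).trans ω)
    · intro ω hω
      rw [Finset.mem_coe, mem_startsIn] at hω
      rw [Finset.mem_coe, Finset.mem_filter, mem_startsIn]
      refine ⟨fun i hi => ?_, ?_⟩
      · have h1 : i ≠ ⟨m, hm⟩ := by rintro rfl; simp at hi
        have h2 : i ≠ j := by rintro rfl; exact hj hi
        simpa [Equiv.swap_apply_of_ne_of_ne h1 h2] using hω i (by omega)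
      · simpa using hω ⟨m, hm⟩ (by simp)
    · intro ω _ ω' _ h
      ext x
      have := congrArg (fun f : Fin N ≃ E => f (Equiv.swap ⟨m, hm⟩ j x)) h
      simpa using this

theorem card_mul_card_startsIn_succ_le (A : Finset E) {m : ℕ} (hm : m < N) :
    N * (startsIn N A (m + 1)).card ≤ A.card * (startsIn N A m).card := by
  calc N * (startsIn N A (m + 1)).card
      = ∑ _j : Fin N, (startsIn N A (m + 1)).card := by simp
    _ ≤ ∑ j : Fin N, ((startsIn N A m).filter fun ω => ω j ∈ A).card :=
        Finset.sum_le_sum fun j _ => card_startsIn_succ_le_filter A hm j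
    _ = ∑ ω ∈ startsIn N A m, (Finset.univ.filter fun j : Fin N => ω j ∈ A).card := by
        simp only [Finset.card_filter]
        exact Finset.sum_comm
    _ = ∑ _ω ∈ startsIn N A m, A.card := by
        refine Finset.sum_congr rfl fun ω _ => ?_
        refine Finset.card_bij (fun j _ => ω j) ?_ ?_ ?_
        · intro j hj; simpa using hj
        · intro i _ j _ h; exact ω.injective h
        · intro e he; exact ⟨ω.symm e, by simpa using he, by simp⟩
    _ = A.card * (startsIn N A m).card := by simp [mul_comm]

theorem pow_mul_card_startsIn_le (A : Finset E) {m : ℕ} (hm : m ≤ N) :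
    N ^ m * (startsIn N A m).card ≤ A.card ^ m * Fintype.card (Fin N ≃ E) := by
  induction m with
  | zero => simpa using Finset.card_le_univ (startsIn N A 0)
  | succ m ih =>
    calc N ^ (m + 1) * (startsIn N A (m + 1)).card
        = N ^ m * (N * (startsIn N A (m + 1)).card) := by ring
      _ ≤ N ^ m * (A.card * (startsIn N A m).card) :=
          Nat.mul_le_mul_left _ (card_mul_card_startsIn_succ_le A hm)
      _ = A.card * (N ^ m * (startsIn N A m).card) := by ring
      _ ≤ A.card * (A.card ^ m * Fintype.card (Fin N ≃ E)) :=
          Nat.mul_le_mul_left _ (ih (by omega))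
      _ = A.card ^ (m + 1) * Fintype.card (Fin N ≃ E) := by ring

end Counting

section Graph

variable {n : ℕ}

/-- The edges with both endpoints in `U`. -/
noncomputable def edgesWithin (U : Finset (Fin n)) : Finset (CEdge n) :=
  Finset.univ.filter fun e => ∀ v ∈ (e : Sym2 (Fin n)), v ∈ U

theorem edegree_eq_card_filter (P : Finset (CEdge n)) (v : Fin n) :
    edegree n P v = (P.filter fun e : CEdge n => v ∈ e.val).card := by
  unfold edegree
  symm
  refine Finset.card_bij (fun e _ => e.val) (fun e he => ?_)
    (fun e _ e' _ h => Subtype.ext h) (fun e he => ?_)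
  · simpa [e.property] using he
  · simp only [Finset.bind_def, Finset.pure_def, Finset.mem_filter, Finset.mem_sup,
      Finset.mem_singleton] at he
    obtain ⟨⟨a, ha, rfl⟩, hv⟩ := he
    exact ⟨a, by simp [ha, hv], rfl⟩

/-- The vertices covered by the edge set `P`. -/
noncomputable def covered (P : Finset (CEdge n)) : Finset (Fin n) :=
  Finset.univ.filter fun v => 0 < edegree n P v

theorem card_edge : Fintype.card (CEdge n) = n.choose 2 := by
  have h := Sym2.card_subtype_not_diag (α := Fin n)
  rw [Fintype.card_fin] at h
  rw [← h]

theorem card_edgesWithin_le (U : Finset (Fin n)) :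
    (edgesWithin U).card ≤ U.card.choose 2 := by
  rw [← Sym2.card_image_offDiag]
  apply Finset.card_le_card_of_injOn (fun e : CEdge n => e.val)
  · rintro ⟨e, he⟩ h
    induction e using Sym2.ind with
    | _ x y =>
      simp only [edgesWithin, Finset.coe_filter, Finset.mem_univ, true_and, Set.mem_ofPred_eq,
        Sym2.mem_iff] at h
      rw [Finset.mem_coe, Finset.mem_image]
      refine ⟨(x, y), ?_, rfl⟩
      rw [Finset.mem_offDiag]
      exact ⟨h x (Or.inl rfl), h y (Or.inr rfl), by simpa using he⟩
  · intro e _ e' _ h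
    exact Subtype.ext h

theorem edegree_mono {P Q : Finset (CEdge n)} (h : P ⊆ Q) (v : Fin n) :
    edegree n P v ≤ edegree n Q v := by
  rw [edegree_eq_card_filter, edegree_eq_card_filter]
  exact Finset.card_le_card (Finset.filter_subset_filter _ h)

theorem edegree_insert_of_mem {P : Finset (CEdge n)} {e : CEdge n} (he : e ∉ P) {v : Fin n}
    (hv : v ∈ (e : Sym2 (Fin n))) : edegree n (insert e P) v = edegree n P v + 1 := by
  rw [edegree_eq_card_filter, edegree_eq_card_filter, Finset.filter_insert, if_pos hv, Finset.card_insert_of_notMem]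
  simp [he]

theorem edegree_univ (v : Fin n) : n - 1 ≤ edegree n Finset.univ v := by
  have h : (Finset.univ.erase v).card = n - 1 := by
    rw [Finset.card_erase_of_mem (Finset.mem_univ v)]; simp
  rw [← h, edegree_eq_card_filter]
  refine Finset.card_le_card_of_surjOn
    (fun e : CEdge n => if h : v ∈ e.val then Sym2.Mem.other h else v) ?_
  intro w hw
  have hw : w ≠ v := by simpa using hw
  have hmem : v ∈ s(v, w) := by simp
  refine ⟨⟨s(v, w), by simpa using hw.symm⟩, by simp, ?_⟩
  simp only [hmem, dif_pos]
  exact Sym2.congr_right.1 (Sym2.other_spec hmem)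

/-- The total degree of `P`, each vertex counting at most `k`. -/
noncomputable def cappedDegreeSum (k : ℕ) (P : Finset (CEdge n)) : ℕ :=
  ∑ v : Fin n, min (edegree n P v) k

theorem cappedDegreeSum_le (k : ℕ) (P : Finset (CEdge n)) : cappedDegreeSum k P ≤ k * n := by
  calc cappedDegreeSum k P ≤ ∑ _v : Fin n, k := Finset.sum_le_sum fun v _ => min_le_right _ _
    _ = k * n := by simp [mul_comm]

theorem card_covered_le_cappedDegreeSum {k : ℕ} (hk : 0 < k) (P : Finset (CEdge n)) :
    (covered P).card ≤ cappedDegreeSum k P := by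
  unfold covered cappedDegreeSum
  rw [Finset.card_filter]
  refine Finset.sum_le_sum fun v _ => ?_
  split_ifs <;> omega

theorem cappedDegreeSum_insert {k : ℕ} {P : Finset (CEdge n)} {e : CEdge n} (he : e ∉ P)
    {v : Fin n} (hv : v ∈ (e : Sym2 (Fin n))) (hlt : edegree n P v < k) :
    cappedDegreeSum k P + 1 ≤ cappedDegreeSum k (insert e P) := by
  rw [Nat.add_one_le_iff]
  refine Finset.sum_lt_sum (fun w _ => ?_) ⟨v, Finset.mem_univ v, ?_⟩
  · exact min_le_min_right k (edegree_mono (Finset.subset_insert e P) w)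
  · rw [edegree_insert_of_mem he hv]
    omega

theorem mem_observed {ω : EdgeOrdering n} {s : ℕ} {e : CEdge n} :
    e ∈ observed n ω s ↔ (ω.symm e : ℕ) < s := by
  simp [observed]

theorem observed_succ (ω : EdgeOrdering n) {s : ℕ} (h : s < Fintype.card (CEdge n)) :
    observed n ω (s + 1) = insert (ω ⟨s, h⟩) (observed n ω s) := by
  ext e
  rw [Finset.mem_insert, mem_observed, mem_observed, ← Equiv.symm_apply_eq, Fin.ext_iff]
  simp only
  omega

theorem observed_eq_univ (ω : EdgeOrdering n) {s : ℕ} (h : Fintype.card (CEdge n) ≤ s) :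
    observed n ω s = Finset.univ := by
  ext e
  simp only [mem_observed, Finset.mem_univ, iff_true]
  exact (ω.symm e).isLt.trans_le h

theorem le_edegree_observed_hitTime {k : ℕ} (hkn : k + 1 ≤ n) (ω : EdgeOrdering n) (v : Fin n) :
    k ≤ edegree n (observed n ω (hitTime n k ω)) v := by
  refine Nat.sInf_mem (s := {s | ∀ v : Fin n, k ≤ edegree n (observed n ω s) v}) ?_ v
  refine ⟨Fintype.card (CEdge n), fun v => ?_⟩
  rw [observed_eq_univ ω le_rfl]
  have := edegree_univ v
  omega

end Graph

section Greedy

variable {n b k : ℕ} {ω : EdgeOrdering n}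

/-- Builder purchases exactly the edges with an endpoint of purchased degree less than `k`. -/
noncomputable def greedy (n k : ℕ) : Strategy n :=
  fun _ P e => decide (∃ v ∈ (e : Sym2 (Fin n)), edegree n P v < k)

theorem build_succ (S : Strategy n) {s : ℕ} (h : s < Fintype.card (CEdge n)) :
    build n b S ω (s + 1) =
      if S s (build n b S ω s) (ω ⟨s, h⟩) = true ∧ (build n b S ω s).card < b then
        insert (ω ⟨s, h⟩) (build n b S ω s) else build n b S ω s := by
  simp only [build, h, dif_pos]

theorem build_succ_of_le (S : Strategy n) {s : ℕ} (h : Fintype.card (CEdge n) ≤ s) :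
    build n b S ω (s + 1) = build n b S ω s := by
  simp only [build, h.not_gt, dif_neg, not_false_eq_true]

theorem card_build_le (S : Strategy n) (s : ℕ) : (build n b S ω s).card ≤ s := by
  induction s with
  | zero => simp [build]
  | succ s ih =>
    rcases lt_or_ge s (Fintype.card (CEdge n)) with h | h
    · rw [build_succ S h]
      split_ifs
      · exact (Finset.card_insert_le _ _).trans (by omega)
      · omega
    · rw [build_succ_of_le S h]
      omega

theorem build_subset_observed (S : Strategy n) (s : ℕ) :
    build n b S ω s ⊆ observed n ω s := by
  induction s with
  | zero => simp [build]
  | succ s ih =>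
    rcases lt_or_ge s (Fintype.card (CEdge n)) with h | h
    · rw [build_succ S h, observed_succ ω h]
      split_ifs
      · exact Finset.insert_subset_insert _ ih
      · exact ih.trans (Finset.subset_insert _ _)
    · rw [observed_eq_univ ω (by omega : Fintype.card (CEdge n) ≤ s + 1)]
      exact Finset.subset_univ _

theorem notMem_build (S : Strategy n) {s : ℕ} (h : s < Fintype.card (CEdge n)) :
    ω ⟨s, h⟩ ∉ build n b S ω s := by
  intro hmem
  have := mem_observed.1 (build_subset_observed S s hmem)
  simp at this

/-- Every purchase by the greedy strategy increases the capped degree sum. -/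
theorem card_add_cappedDegreeSum_le {s t : ℕ} (hst : s ≤ t) :
    (build n b (greedy n k) ω t).card + cappedDegreeSum k (build n b (greedy n k) ω s) ≤
      (build n b (greedy n k) ω s).card + cappedDegreeSum k (build n b (greedy n k) ω t) := by
  induction t, hst using Nat.le_induction with
  | base => exact le_rfl
  | succ t hst ih =>
    rcases lt_or_ge t (Fintype.card (CEdge n)) with h | h
    · rw [build_succ _ h]
      split_ifs with hc
      · obtain ⟨v, hv, hlt⟩ := of_decide_eq_true hc.1
        have h1 := cappedDegreeSum_insert (notMem_build _ h) hv hlt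
        rw [Finset.card_insert_of_notMem (notMem_build _ h)]
        omega
      · exact ih
    · rw [build_succ_of_le _ h]
      exact ih

/-- Unless the budget runs out, the greedy strategy misses no edge at a vertex whose degree is
still below `k`. -/
theorem min_edegree_observed_le {t : ℕ}
    (hb : ∀ s < t, (build n b (greedy n k) ω s).card < b) (v : Fin n) :
    min (edegree n (observed n ω t) v) k ≤ edegree n (build n b (greedy n k) ω t) v := by
  suffices h : k ≤ edegree n (build n b (greedy n k) ω t) v ∨
      ∀ e ∈ observed n ω t, v ∈ (e : Sym2 (Fin n)) → e ∈ build n b (greedy n k) ω t by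
    rcases h with h | h
    · exact (min_le_right _ _).trans h
    · rw [edegree_eq_card_filter (build n b (greedy n k) ω t), edegree_eq_card_filter]
      refine (min_le_left _ _).trans (Finset.card_le_card fun e he => ?_)
      rw [Finset.mem_filter] at he ⊢
      exact ⟨h e he.1 he.2, he.2⟩
  induction t with
  | zero => right; simp [mem_observed]
  | succ t ih =>
    rcases lt_or_ge t (Fintype.card (CEdge n)) with h | h
    · have hsub : build n b (greedy n k) ω t ⊆ build n b (greedy n k) ω (t + 1) := by
        rw [build_succ _ h]
        split_ifs
        · exact Finset.subset_insert _ _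
        · exact subset_rfl
      rcases le_or_gt k (edegree n (build n b (greedy n k) ω t) v) with hd | hd
      · exact Or.inl (hd.trans (edegree_mono hsub v))
      · have hold := (ih fun s hs => hb s (by omega)).resolve_left (by omega)
        right
        intro e he hv
        rw [observed_succ ω h, Finset.mem_insert] at he
        rcases he with rfl | he
        · rw [build_succ _ h, if_pos ⟨decide_eq_true ⟨v, hv, hd⟩, hb t (by omega)⟩]
          exact Finset.mem_insert_self _ _
        · exact hsub (hold e he hv)
    · rw [build_succ_of_le _ h, observed_eq_univ ω (by omega : Fintype.card (CEdge n) ≤ t + 1),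
        ← observed_eq_univ ω h]
      exact ih fun s hs => hb s (by omega)

/-- If the first `m` edges cover many vertices then the greedy strategy succeeds. -/
theorem greedy_succeeds (hk : 0 < k) (hkn : k + 1 ≤ n) {m r : ℕ} (hmb : m < b)
    (hrb : k * n < b + r) (hcov : m + r ≤ (covered (observed n ω m)).card) (v : Fin n) :
    k ≤ edegree n (build n b (greedy n k) ω (hitTime n k ω)) v := by
  have hearly : ∀ s ≤ m, (build n b (greedy n k) ω s).card < b := fun s hs =>
    (card_build_le _ s).trans_lt (by omega)
  have hcap : m + r ≤ cappedDegreeSum k (build n b (greedy n k) ω m) := by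
    refine hcov.trans (le_trans (Finset.card_le_card fun v hv => ?_)
      (card_covered_le_cappedDegreeSum hk _))
    have := min_edegree_observed_le (t := m) (fun s hs => hearly s hs.le) v
    simp only [covered, Finset.mem_filter, Finset.mem_univ, true_and] at hv ⊢
    omega
  have hb : ∀ s, (build n b (greedy n k) ω s).card < b := by
    intro s
    rcases le_total s m with h | h
    · exact hearly s h
    · have h1 := card_add_cappedDegreeSum_le (b := b) (k := k) (ω := ω) h
      have h2 := card_build_le (b := b) (ω := ω) (greedy n k) m
      have h3 := cappedDegreeSum_le k (build n b (greedy n k) ω s)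
      omega
  have h1 := min_edegree_observed_le (t := hitTime n k ω) (fun s _ => hb s) v
  have h2 := le_edegree_observed_hitTime hkn ω v
  omega

end Greedy

section Probability

theorem uprob_le_one {α : Type} [Fintype α] (P : α → Prop) : uprob P ≤ 1 :=
  div_le_one_of_le₀ (by exact_mod_cast Finset.card_le_univ _) (by positivity)

theorem one_le_uprob_add_uprob {α : Type} [Fintype α] [Nonempty α] {P Q : α → Prop}
    (h : ∀ a, ¬ Q a → P a) : 1 ≤ uprob P + uprob Q := by
  unfold uprob
  have hpos : (0 : ℝ) < Fintype.card α := by exact_mod_cast Fintype.card_pos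
  rw [← add_div, one_le_div hpos]
  have : Fintype.card α ≤ (Finset.univ.filter P).card + (Finset.univ.filter Q).card := by
    rw [← Finset.card_univ]
    refine (Finset.card_le_card fun a _ => ?_).trans (Finset.card_union_le _ _)
    by_cases hQ : Q a
    · simp [hQ]
    · simp [h a hQ]
  exact_mod_cast this

theorem uprob_le_card_div {α : Type} [Fintype α] {P : α → Prop} {s : Finset α}
    (h : ∀ a, P a → a ∈ s) : uprob P ≤ s.card / Fintype.card α := by
  unfold uprob
  gcongr
  exact fun a ha => h a (by simpa using ha)

theorem nonempty_edgeOrdering (n : ℕ) : Nonempty (EdgeOrdering n) :=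
  ⟨(Fintype.equivFin _).symm⟩

/-- First moment bound for the event that few vertices are covered by the first `m` edges. -/
theorem uprob_covered_le {n m u : ℕ} (hu : u ≤ n) (hm : m ≤ n.choose 2) (hn : 2 ≤ n) :
    uprob (fun ω : EdgeOrdering n => (covered (observed n ω m)).card ≤ u) ≤
      n.choose u * ((u.choose 2 : ℝ) / n.choose 2) ^ m := by
  have hpos : (0 : ℝ) < n.choose 2 := by exact_mod_cast Nat.choose_pos hn
  have hOpos : (0 : ℝ) < Fintype.card (EdgeOrdering n) := by
    have := nonempty_edgeOrdering n
    exact_mod_cast Fintype.card_pos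
  have hsub : ∀ ω : EdgeOrdering n, (covered (observed n ω m)).card ≤ u →
      ω ∈ (Finset.univ.powersetCard u : Finset (Finset (Fin n))).biUnion
        fun U => startsIn _ (edgesWithin U) m := by
    intro ω hω
    obtain ⟨U, hU, -, hcard⟩ := Finset.exists_subsuperset_card_eq
      (Finset.subset_univ (covered (observed n ω m))) hω (by simpa using hu)
    rw [Finset.mem_biUnion]
    refine ⟨U, by simp [Finset.mem_powersetCard, hcard], mem_startsIn.2 fun i hi => ?_⟩
    simp only [edgesWithin, Finset.mem_filter, Finset.mem_univ, true_and]
    intro v hv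
    apply hU
    simp only [covered, Finset.mem_filter, Finset.mem_univ, true_and]
    rw [edegree_eq_card_filter]
    exact Finset.card_pos.2 ⟨ω i, by simp [mem_observed, hi, hv]⟩
  have hterm : ∀ U ∈ (Finset.univ.powersetCard u : Finset (Finset (Fin n))),
      ((startsIn (Fintype.card (CEdge n)) (edgesWithin U) m).card : ℝ) ≤
        ((u.choose 2 : ℝ) / n.choose 2) ^ m * Fintype.card (EdgeOrdering n) := by
    intro U hU
    have hUc : U.card = u := (Finset.mem_powersetCard.1 hU).2
    have h1 := pow_mul_card_startsIn_le (edgesWithin U) (m := m) (card_edge (n := n) ▸ hm)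
    have h2 : (edgesWithin U).card ^ m ≤ (u.choose 2) ^ m :=
      Nat.pow_le_pow_left (hUc ▸ card_edgesWithin_le U) m
    have h3 := h1.trans (Nat.mul_le_mul_right _ h2)
    have h4 : ((n.choose 2 : ℝ)) ^ m *
        (startsIn (Fintype.card (CEdge n)) (edgesWithin U) m).card ≤
        (u.choose 2 : ℝ) ^ m * Fintype.card (EdgeOrdering n) := by
      rw [← card_edge (n := n)]
      exact_mod_cast h3
    rw [div_pow, div_mul_eq_mul_div, le_div_iff₀ (by positivity)]
    linarith
  refine (uprob_le_card_div hsub).trans ?_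
  rw [div_le_iff₀ hOpos]
  calc (((Finset.univ.powersetCard u : Finset (Finset (Fin n))).biUnion
        fun U => startsIn _ (edgesWithin U) m).card : ℝ)
      ≤ ∑ U ∈ (Finset.univ.powersetCard u : Finset (Finset (Fin n))),
          ((startsIn (Fintype.card (CEdge n)) (edgesWithin U) m).card : ℝ) := by
        exact_mod_cast Finset.card_biUnion_le
    _ ≤ ∑ _U ∈ (Finset.univ.powersetCard u : Finset (Finset (Fin n))),
          ((u.choose 2 : ℝ) / n.choose 2) ^ m * Fintype.card (EdgeOrdering n) :=
        Finset.sum_le_sum hterm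
    _ = n.choose u * ((u.choose 2 : ℝ) / n.choose 2) ^ m * Fintype.card (EdgeOrdering n) := by
        rw [Finset.sum_const, Finset.card_powersetCard, Finset.card_univ, Fintype.card_fin,
          nsmul_eq_mul, mul_assoc]

theorem choose_two_div_le {u n : ℕ} (hn : 2 ≤ n) (hu : u ≤ n) :
    (u.choose 2 : ℝ) / n.choose 2 ≤ ((u : ℝ) / n) ^ 2 := by
  have hn' : (2 : ℝ) ≤ n := by exact_mod_cast hn
  have hu' : (u : ℝ) ≤ n := by exact_mod_cast hu
  have hu0 : (0 : ℝ) ≤ u := by positivity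
  rw [Nat.cast_choose_two, Nat.cast_choose_two, div_pow,
    div_le_div_iff₀ (by nlinarith) (by nlinarith)]
  nlinarith [mul_nonneg (mul_nonneg hu0 (by linarith : (0 : ℝ) ≤ n)) (sub_nonneg.2 hu')]

theorem choose_mul_pow_le {n r : ℕ} (hr : 1000 * r ≤ n) (hn : 2 ≤ n) :
    (n.choose (3 * r) : ℝ) * (((3 * r).choose 2 : ℝ) / n.choose 2) ^ (2 * r) ≤
      (1 / 2 : ℝ) ^ r := by
  have hn0 : (0 : ℝ) < n := by positivity
  set x : ℝ := ((3 * r : ℕ) : ℝ) / n with hx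
  have hx0 : 0 ≤ x := by positivity
  have hxs : x ≤ 3 / 1000 := by
    rw [hx, div_le_div_iff₀ hn0 (by norm_num)]
    have : (1000 * r : ℝ) ≤ n := by exact_mod_cast hr
    push_cast
    linarith
  have h1 : (((3 * r).choose 2 : ℝ) / n.choose 2) ^ (2 * r) ≤ (x ^ 2) ^ (2 * r) :=
    pow_le_pow_left₀ (by positivity) (choose_two_div_le hn (by omega)) _
  have h2 : (n.choose (3 * r) : ℝ) ≤ (n : ℝ) ^ (3 * r) / (3 * r).factorial :=
    Nat.choose_le_pow_div _ _
  have h3 : (((3 * r : ℕ) : ℝ)) ^ (3 * r) / (3 * r).factorial ≤ Real.exp ((3 * r : ℕ) : ℝ) :=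
    Real.pow_div_factorial_le_exp _ (by positivity) _
  have h4 : Real.exp ((3 * r : ℕ) : ℝ) ≤ 27 ^ r := by
    have he : Real.exp 1 ≤ 3 := by linarith [Real.exp_one_lt_d9]
    calc Real.exp ((3 * r : ℕ) : ℝ) = Real.exp 1 ^ (3 * r) := by rw [← Real.exp_nat_mul]; simp
      _ ≤ 3 ^ (3 * r) := pow_le_pow_left₀ (Real.exp_pos 1).le he _
      _ = 27 ^ r := by rw [pow_mul]; norm_num
  have hnx : (n : ℝ) * x = ((3 * r : ℕ) : ℝ) := by rw [hx]; field_simp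
  calc (n.choose (3 * r) : ℝ) * (((3 * r).choose 2 : ℝ) / n.choose 2) ^ (2 * r)
      ≤ ((n : ℝ) ^ (3 * r) / (3 * r).factorial) * (x ^ 2) ^ (2 * r) :=
        mul_le_mul h2 h1 (by positivity) (by positivity)
    _ = ((n * x) ^ (3 * r) / (3 * r).factorial) * x ^ r := by
        rw [mul_pow]
        ring
    _ ≤ 27 ^ r * (3 / 1000) ^ r := by
        rw [hnx]
        exact mul_le_mul (h3.trans h4) (pow_le_pow_left₀ hx0 hxs r) (by positivity) (by positivity)
    _ = (27 * (3 / 1000)) ^ r := (mul_pow _ _ _).symm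
    _ ≤ (1 / 2) ^ r := pow_le_pow_left₀ (by norm_num) (by norm_num) r

end Probability

/-- Minimum degree at the hitting time: there are constants `k/2 ≤ o_k < k` and `c_k > 0`
such that whenever `b(n) ≥ o_k n + c_k √n log n`, Builder has a `(τ_k, b)`-strategy whose
purchased graph has minimum degree at least `k` at time `τ_k`, with high probability. -/
theorem stmt0 (k : ℕ) (hk : 0 < k) :
    ∃ ok ck : ℝ, (k : ℝ) / 2 ≤ ok ∧ ok < k ∧ 0 < ck ∧
      ∀ b : ℕ → ℕ, (∀ n : ℕ, ok * (n : ℝ) + ck * Real.sqrt n * Real.log n ≤ (b n : ℝ)) →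
        ∃ S : (n : ℕ) → Strategy n,
          Tendsto
            (fun n => uprob (fun ω : EdgeOrdering n =>
              ∀ v : Fin n, k ≤ edegree n (build n (b n) (S n) ω (hitTime n k ω)) v))
            atTop (nhds 1) := by
  refine ⟨k - 1 / 4000, 1, ?_, by linarith, one_pos, fun b hb => ⟨fun n => greedy n k, ?_⟩⟩
  · have : (1 : ℝ) ≤ k := by exact_mod_cast hk
    linarith
  have hlim : Tendsto (fun n : ℕ => 1 - (1 / 2 : ℝ) ^ (n / 1000)) atTop (nhds 1) := by
    have := (tendsto_pow_atTop_nhds_zero_of_lt_one (r := (1 / 2 : ℝ)) (by norm_num)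
      (by norm_num)).comp (Nat.tendsto_div_const_atTop (n := 1000) (by norm_num))
    simpa using this.const_sub 1
  refine tendsto_of_tendsto_of_tendsto_of_le_of_le' hlim tendsto_const_nhds ?_
    (Eventually.of_forall fun n => uprob_le_one _)
  filter_upwards [eventually_ge_atTop (4000 + k)] with n hn
  have := nonempty_edgeOrdering n
  have hn' : (4000 : ℝ) ≤ n := by exact_mod_cast (by omega : 4000 ≤ n)
  have hk' : (1 : ℝ) ≤ k := by exact_mod_cast hk
  have hr : 1000 * (n / 1000) ≤ n := Nat.mul_div_le n 1000
  have hr' : (n : ℝ) < 1000 * ((n / 1000 : ℕ) : ℝ) + 1000 := by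
    exact_mod_cast (by omega : n < 1000 * (n / 1000) + 1000)
  have hr'' : 1000 * ((n / 1000 : ℕ) : ℝ) ≤ n := by exact_mod_cast hr
  have hbn : (k - 1 / 4000 : ℝ) * n ≤ b n := by
    refine le_trans ?_ (hb n)
    have := mul_nonneg (Real.sqrt_nonneg n) (Real.log_natCast_nonneg n)
    linarith
  have hmb : 2 * (n / 1000) < b n := by
    have : (2 * ((n / 1000 : ℕ) : ℝ)) < b n := by nlinarith
    exact_mod_cast this
  have hrb : k * n < b n + n / 1000 := by
    have : (k * n : ℝ) < b n + ((n / 1000 : ℕ) : ℝ) := by linarith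
    exact_mod_cast this
  have hm : 2 * (n / 1000) ≤ n.choose 2 := by
    rw [Nat.choose_two_right, Nat.le_div_iff_mul_le (by norm_num)]
    calc 2 * (n / 1000) * 2 ≤ n * 1 := by omega
      _ ≤ n * (n - 1) := Nat.mul_le_mul_left _ (by omega)
  have hbad := (uprob_covered_le (u := 3 * (n / 1000)) (by omega) hm (by omega)).trans
    (choose_mul_pow_le hr (by omega))
  have hgood := one_le_uprob_add_uprob
    (P := fun ω : EdgeOrdering n =>
      ∀ v : Fin n, k ≤ edegree n (build n (b n) (greedy n k) ω (hitTime n k ω)) v)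
    (Q := fun ω => (covered (observed n ω (2 * (n / 1000)))).card ≤ 3 * (n / 1000))
    (fun ω hω => greedy_succeeds hk (by omega) hmb hrb (by omega))
  linarith
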